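/- arXiv:2601.08771 — 2 statements merged into one kernel-verified Lean document; each statement's English description precedes it below -/
import Mathlib

section
/- Let u₀ : ℝ → ℝ be continuous and bounded, nonincreasing on (−∞,0], nondecreasing on [0,∞), with u₀(0) < 0 and u₀(x) → 0 as |x| → ∞, and set T* = −1/u₀(0) > 0. Then there exists a continuous function u : ℝ × [0,T*) → ℝ such that: (i) u(x,0) = u₀(x) for all x; (ii) u is a weak solution of u_t + (x u²)_x = 0 on ℝ × (0,T*) with initial datum u₀; (iii) for every ξ ∈ ℝ and every t ∈ [0,T*), u(ξ·(1 + t·u₀(ξ))², t) = u₀(ξ)/(1 + t·u₀(ξ)); and (iv) for every t ∈ [0,T*), sup_{x ∈ ℝ} |u(x,t)| = −u₀(0)/(1 + t·u₀(0)); in particular the L∞ norm of u(·,t) tends to ∞ as t → T*⁻, i.e. the solution blows up in L∞ in finite time despite bounded initial data. -/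
open MeasureTheory Set Filter

/-- `u` is a weak solution of `u_t + (x u²)_x = 0` on `ℝ × (0,T)` with initial datum `u₀`:
`u` and the flux `x u²` are locally integrable on the strip, and the integral identity holds
for every smooth compactly supported test function with support in `ℝ × (−∞,T)`.
Points of `ℝ × ℝ` are written `(x, t)`. -/
def IsWeakSolution (T : ℝ) (u : ℝ × ℝ → ℝ) (u₀ : ℝ → ℝ) : Prop :=
  LocallyIntegrableOn u (univ ×ˢ Ioo 0 T) volume ∧
  LocallyIntegrableOn (fun p => p.1 * (u p) ^ 2) (univ ×ˢ Ioo 0 T) volume ∧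
  ∀ φ : ℝ × ℝ → ℝ, ContDiff ℝ (⊤ : ℕ∞) φ → HasCompactSupport φ →
    tsupport φ ⊆ univ ×ˢ Iio T →
    (∫ t in Ioo (0 : ℝ) T, ∫ x : ℝ,
        (u (x, t) * fderiv ℝ φ (x, t) (0, 1)
          + x * (u (x, t)) ^ 2 * fderiv ℝ φ (x, t) (1, 0)))
      + ∫ x : ℝ, u₀ x * φ (x, 0) = 0


lemma bc_expand (u₀ : ℝ → ℝ) (hdec : AntitoneOn u₀ (Iic 0)) (hinc : MonotoneOn u₀ (Ici 0))
    (h1 : ∀ ξ, u₀ 0 ≤ u₀ ξ) (h2 : ∀ ξ, u₀ ξ ≤ 0) (t : ℝ) (ht : 0 ≤ t) (hc : 0 < 1 + t * u₀ 0)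
    (ξ η : ℝ) (h : ξ ≤ η) :
    (1 + t * u₀ 0) ^ 2 * (η - ξ) ≤ η * (1 + t * u₀ η) ^ 2 - ξ * (1 + t * u₀ ξ) ^ 2 := by
  have k1 : ∀ x, (1 + t * u₀ 0) ≤ (1 + t * u₀ x) := fun x => by
    have := mul_le_mul_of_nonneg_left (h1 x) ht; linarith
  have k3 : ∀ x, (1 + t * u₀ 0) ^ 2 ≤ (1 + t * u₀ x) ^ 2 := fun x =>
    pow_le_pow_left₀ hc.le (k1 x) 2
  have mono : ∀ x y, u₀ x ≤ u₀ y → (1 + t * u₀ x) ^ 2 ≤ (1 + t * u₀ y) ^ 2 := fun x y hxy => by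
    have := mul_le_mul_of_nonneg_left hxy ht
    exact pow_le_pow_left₀ (hc.le.trans (k1 x)) (by linarith) 2
  have hξ := k3 ξ
  have hη := k3 η
  rcases le_total 0 ξ with h0 | h0
  · have := mono ξ η (hinc h0 (h0.trans h) h)
    nlinarith [mul_nonneg (h0.trans h) (sub_nonneg.2 this), mul_nonneg (sub_nonneg.2 h) (sub_nonneg.2 hξ)]
  · rcases le_total 0 η with h3 | h3
    · nlinarith [mul_nonneg h3 (sub_nonneg.2 hη), mul_nonneg (neg_nonneg.2 h0) (sub_nonneg.2 hξ)]
    · have := mono η ξ (hdec h0 h3 h)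
      nlinarith [mul_nonneg (neg_nonneg.2 h0) (sub_nonneg.2 this), mul_nonneg (sub_nonneg.2 h) (sub_nonneg.2 hη)]

lemma bc_expand_abs (u₀ : ℝ → ℝ) (hdec : AntitoneOn u₀ (Iic 0)) (hinc : MonotoneOn u₀ (Ici 0))
    (h1 : ∀ ξ, u₀ 0 ≤ u₀ ξ) (h2 : ∀ ξ, u₀ ξ ≤ 0) (t : ℝ) (ht : 0 ≤ t) (hc : 0 < 1 + t * u₀ 0)
    (ξ η : ℝ) :
    (1 + t * u₀ 0) ^ 2 * |η - ξ| ≤ |η * (1 + t * u₀ η) ^ 2 - ξ * (1 + t * u₀ ξ) ^ 2| := by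
  rcases le_total ξ η with h | h
  · rw [abs_of_nonneg (sub_nonneg.2 h)]
    exact (bc_expand u₀ hdec hinc h1 h2 t ht hc ξ η h).trans (le_abs_self _)
  · rw [abs_sub_comm, abs_of_nonneg (sub_nonneg.2 h), abs_sub_comm]
    exact (bc_expand u₀ hdec hinc h1 h2 t ht hc η ξ h).trans (le_abs_self _)

/-- the mixed term is controlled by the displacement -/
lemma bc_mixed (u₀ : ℝ → ℝ) (hdec : AntitoneOn u₀ (Iic 0)) (hinc : MonotoneOn u₀ (Ici 0))
    (h1 : ∀ ξ, u₀ 0 ≤ u₀ ξ) (h2 : ∀ ξ, u₀ ξ ≤ 0) (t : ℝ) (ht : 0 ≤ t) (hc : 0 < 1 + t * u₀ 0)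
    (ξ η : ℝ) :
    (1 + t * u₀ 0) ^ 2 * |t * η * (u₀ η - u₀ ξ)| ≤
      |η * (1 + t * u₀ η) ^ 2 - ξ * (1 + t * u₀ ξ) ^ 2| := by
  have k1 : ∀ x, (1 + t * u₀ 0) ≤ (1 + t * u₀ x) := fun x => by
    have := mul_le_mul_of_nonneg_left (h1 x) ht; linarith
  have k2 : ∀ x, t * u₀ x ≤ 0 := fun x => mul_nonpos_of_nonneg_of_nonpos ht (h2 x)
  have hE := bc_expand_abs u₀ hdec hinc h1 h2 t ht hc ξ η
  set c := 1 + t * u₀ 0 with hcdef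
  have hc1 : c ≤ 1 := by have := k2 0; linarith
  have hd : |t * (u₀ η - u₀ ξ)| ≤ 1 := by
    rw [abs_le]; constructor <;> nlinarith [k1 ξ, k1 η, k2 ξ, k2 η]
  -- opposite sides
  have opp : |η| ≤ |η - ξ| → c ^ 2 * |t * η * (u₀ η - u₀ ξ)| ≤
      |η * (1 + t * u₀ η) ^ 2 - ξ * (1 + t * u₀ ξ) ^ 2| := by
    intro h
    refine le_trans ?_ hE
    have : |t * η * (u₀ η - u₀ ξ)| = |η| * |t * (u₀ η - u₀ ξ)| := by
      rw [← abs_mul]; congr 1; ring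
    rw [this]
    refine mul_le_mul_of_nonneg_left ?_ (by positivity)
    calc |η| * |t * (u₀ η - u₀ ξ)| ≤ |η| * 1 := mul_le_mul_of_nonneg_left hd (abs_nonneg _)
      _ ≤ _ := by simpa using h
  -- same side
  have same : 0 ≤ (η - ξ) * (η * (u₀ η - u₀ ξ)) → c ^ 2 * |t * η * (u₀ η - u₀ ξ)| ≤
      |η * (1 + t * u₀ η) ^ 2 - ξ * (1 + t * u₀ ξ) ^ 2| := by
    intro h
    have e : η * (1 + t * u₀ η) ^ 2 - ξ * (1 + t * u₀ ξ) ^ 2 =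
      (1 + t * u₀ ξ) ^ 2 * (η - ξ) + ((1 + t * u₀ η) + (1 + t * u₀ ξ)) * (t * η * (u₀ η - u₀ ξ)) := by
      ring
    have hp : 0 ≤ (1 + t * u₀ ξ) ^ 2 * (η - ξ) *
        (((1 + t * u₀ η) + (1 + t * u₀ ξ)) * (t * η * (u₀ η - u₀ ξ))) := by
      have a1 : 0 ≤ ((1 + t * u₀ η) + (1 + t * u₀ ξ)) := by linarith [k1 ξ, k1 η]
      have := mul_nonneg (mul_nonneg (mul_nonneg (sq_nonneg (1 + t * u₀ ξ)) a1) ht) h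
      nlinarith [this]
    have hab : ∀ a b : ℝ, 0 ≤ a * b → |b| ≤ |a + b| := fun a b hab =>
      sq_le_sq.1 (by nlinarith [sq_nonneg a] : b ^ 2 ≤ (a + b) ^ 2)
    rw [e]
    refine le_trans ?_ (hab _ _ hp)
    rw [abs_mul _ (t * η * (u₀ η - u₀ ξ))]
    have hcs : c ^ 2 ≤ |(1 + t * u₀ η) + (1 + t * u₀ ξ)| :=
      le_trans (by nlinarith [k1 ξ, k1 η]) (le_abs_self _)
    exact mul_le_mul_of_nonneg_right hcs (abs_nonneg (t * η * (u₀ η - u₀ ξ)))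
  rcases le_total 0 ξ with h0 | h0 <;> rcases le_total 0 η with h3 | h3
  · apply same
    rcases le_total ξ η with h | h
    · have := hinc h0 h3 h
      exact mul_nonneg (by linarith) (mul_nonneg h3 (by linarith))
    · have := hinc h3 h0 h
      exact mul_nonneg_of_nonpos_of_nonpos (by linarith) (mul_nonpos_of_nonneg_of_nonpos h3 (by linarith))
  · apply opp; rw [abs_of_nonpos h3, abs_of_nonpos (by linarith : η - ξ ≤ 0)]; linarith
  · apply opp; rw [abs_of_nonneg h3, abs_of_nonneg (by linarith : 0 ≤ η - ξ)]; linarith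
  · apply same
    rcases le_total ξ η with h | h
    · have := hdec h0 h3 h
      exact mul_nonneg (by linarith) (mul_nonneg_of_nonpos_of_nonpos h3 (by linarith))
    · have := hdec h3 h0 h
      exact mul_nonneg_of_nonpos_of_nonpos (by linarith) (mul_nonpos_of_nonpos_of_nonneg h3 (by linarith))

/-- second order estimate for the potential along characteristics -/
lemma bc_potential (u₀ : ℝ → ℝ) (hcont : Continuous u₀)
    (hdec : AntitoneOn u₀ (Iic 0)) (hinc : MonotoneOn u₀ (Ici 0))
    (h1 : ∀ ξ, u₀ 0 ≤ u₀ ξ) (h2 : ∀ ξ, u₀ ξ ≤ 0) (t : ℝ) (ht : 0 ≤ t) (hc : 0 < 1 + t * u₀ 0)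
    (ξ η ε : ℝ) (hε : ∀ z ∈ uIcc ξ η, |u₀ z - u₀ ξ| ≤ ε) :
    |((∫ z in (0:ℝ)..η, u₀ z) + t * η * u₀ η ^ 2) - ((∫ z in (0:ℝ)..ξ, u₀ z) + t * ξ * u₀ ξ ^ 2)
      - u₀ ξ / (1 + t * u₀ ξ) * (η * (1 + t * u₀ η) ^ 2 - ξ * (1 + t * u₀ ξ) ^ 2)| ≤
    (1 / (1 + t * u₀ 0) ^ 2 + 1 / (1 + t * u₀ 0) ^ 3) * ε *
      |η * (1 + t * u₀ η) ^ 2 - ξ * (1 + t * u₀ ξ) ^ 2| := by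
  have hs : 1 + t * u₀ 0 ≤ 1 + t * u₀ ξ := by
    have := mul_le_mul_of_nonneg_left (h1 ξ) ht; linarith
  have hs0 : 0 < 1 + t * u₀ ξ := hc.trans_le hs
  have hE := bc_expand_abs u₀ hdec hinc h1 h2 t ht hc ξ η
  have hM := bc_mixed u₀ hdec hinc h1 h2 t ht hc ξ η
  have hint : (∫ z in (0:ℝ)..η, u₀ z) - (∫ z in (0:ℝ)..ξ, u₀ z) - u₀ ξ * (η - ξ)
      = ∫ z in ξ..η, (u₀ z - u₀ ξ) := by
    rw [intervalIntegral.integral_interval_sub_left (hcont.intervalIntegrable _ _)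
      (hcont.intervalIntegrable _ _), intervalIntegral.integral_sub (hcont.intervalIntegrable _ _)
      (by simp)]
    simp; ring
  have hI : |∫ z in ξ..η, (u₀ z - u₀ ξ)| ≤ ε * |η - ξ| := by
    have := intervalIntegral.norm_integral_le_of_norm_le_const (a := ξ) (b := η) (C := ε)
      (f := fun z => u₀ z - u₀ ξ) (fun z hz => by
        simpa using hε z (uIoc_subset_uIcc hz))
    simpa using this
  have e : ((∫ z in (0:ℝ)..η, u₀ z) + t * η * u₀ η ^ 2) - ((∫ z in (0:ℝ)..ξ, u₀ z) + t * ξ * u₀ ξ ^ 2)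
      - u₀ ξ / (1 + t * u₀ ξ) * (η * (1 + t * u₀ η) ^ 2 - ξ * (1 + t * u₀ ξ) ^ 2)
      = (∫ z in ξ..η, (u₀ z - u₀ ξ)) +
        (t * η * (u₀ η - u₀ ξ)) * (u₀ η - u₀ ξ) / (1 + t * u₀ ξ) := by
    rw [← hint]; field_simp; ring
  have hε0 : |u₀ η - u₀ ξ| ≤ ε := hε η right_mem_uIcc
  have hεn : 0 ≤ ε := (abs_nonneg _).trans hε0
  rw [e]
  refine (abs_add_le _ _).trans ?_
  rw [abs_div, abs_mul, abs_of_pos hs0]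
  set D := |η * (1 + t * u₀ η) ^ 2 - ξ * (1 + t * u₀ ξ) ^ 2|
  set c := 1 + t * u₀ 0
  have b1 : |η - ξ| ≤ D / c ^ 2 := by rw [le_div_iff₀ (by positivity)]; linarith
  have b2 : |t * η * (u₀ η - u₀ ξ)| ≤ D / c ^ 2 := by rw [le_div_iff₀ (by positivity)]; linarith
  have : |t * η * (u₀ η - u₀ ξ)| * |u₀ η - u₀ ξ| / (1 + t * u₀ ξ) ≤ D / c ^ 2 * ε / c := by
    gcongr
  calc _ ≤ ε * (D / c ^ 2) + D / c ^ 2 * ε / c :=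
        add_le_add (hI.trans (mul_le_mul_of_nonneg_left b1 hεn)) this
    _ = _ := by field_simp

lemma bc_exists_inv (u₀ : ℝ → ℝ) (hcont : Continuous u₀)
    (h1 : ∀ ξ, u₀ 0 ≤ u₀ ξ) (t : ℝ) (ht : 0 ≤ t) (hc : 0 < 1 + t * u₀ 0) (x : ℝ) :
    ∃ ξ, ξ * (1 + t * u₀ ξ) ^ 2 = x := by
  have k3 : ∀ x, (1 + t * u₀ 0) ^ 2 ≤ (1 + t * u₀ x) ^ 2 := fun x => by
    have := mul_le_mul_of_nonneg_left (h1 x) ht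
    exact pow_le_pow_left₀ hc.le (by linarith) 2
  set c := (1 + t * u₀ 0) ^ 2
  have hc2 : 0 < c := by positivity
  have hcX : Continuous fun ξ => ξ * (1 + t * u₀ ξ) ^ 2 := by fun_prop
  have hR : 0 ≤ |x| / c := by positivity
  have hxc : |x| / c * c = |x| := by field_simp
  obtain ⟨ξ, -, hξ⟩ := intermediate_value_Icc (a := -(|x| / c)) (b := |x| / c) (by linarith)
    hcX.continuousOn (show x ∈ Icc _ _ from ⟨by
      nlinarith [mul_le_mul_of_nonneg_left (k3 (-(|x| / c))) hR, neg_abs_le x], by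
      nlinarith [mul_le_mul_of_nonneg_left (k3 (|x| / c)) hR, le_abs_self x]⟩)
  exact ⟨ξ, hξ⟩

lemma bc_Y_cont (u₀ : ℝ → ℝ) (hdec : AntitoneOn u₀ (Iic 0)) (hinc : MonotoneOn u₀ (Ici 0))
    (h1 : ∀ ξ, u₀ 0 ≤ u₀ ξ) (h2 : ∀ ξ, u₀ ξ ≤ 0) (T : ℝ)
    (hc : ∀ t, 0 ≤ t → t < T → 0 < 1 + t * u₀ 0) (Y : ℝ × ℝ → ℝ)
    (hY : ∀ x t, 0 ≤ t → t < T → Y (x, t) * (1 + t * u₀ (Y (x, t))) ^ 2 = x) :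
    ContinuousOn Y (univ ×ˢ Ico 0 T) := by
  rintro ⟨x, t⟩ ⟨-, ht0, htT⟩
  simp only at ht0 htT
  set ξ := Y (x, t) with hξ
  have key : Tendsto (fun p : ℝ × ℝ => |p.1 - ξ * (1 + p.2 * u₀ ξ) ^ 2| / (1 + p.2 * u₀ 0) ^ 2)
      (nhdsWithin (x, t) (univ ×ˢ Ico 0 T)) (nhds 0) := by
    have : ContinuousAt (fun p : ℝ × ℝ => |p.1 - ξ * (1 + p.2 * u₀ ξ) ^ 2| / (1 + p.2 * u₀ 0) ^ 2)
      (x, t) := by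
      refine ContinuousAt.div (by fun_prop) (by fun_prop) ?_
      have := hc t ht0 htT
      simp only
      positivity
    have h := this.continuousWithinAt (s := univ ×ˢ Ico 0 T)
    unfold ContinuousWithinAt at h
    simpa [hξ, hY x t ht0 htT] using h
  unfold ContinuousWithinAt
  rw [tendsto_iff_dist_tendsto_zero]
  refine squeeze_zero' (Eventually.of_forall fun _ => dist_nonneg) ?_ key
  filter_upwards [self_mem_nhdsWithin] with p hp
  obtain ⟨x', t'⟩ := p
  obtain ⟨-, ht0', htT'⟩ := hp
  simp only at ht0' htT' ⊢
  have hc' := hc t' ht0' htT'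
  rw [le_div_iff₀ (by positivity), Real.dist_eq]
  have := bc_expand_abs u₀ hdec hinc h1 h2 t' ht0' hc' ξ (Y (x', t'))
  rw [hY x' t' ht0' htT'] at this
  linarith

lemma bc_fderiv (u₀ : ℝ → ℝ) (hcont : Continuous u₀)
    (hdec : AntitoneOn u₀ (Iic 0)) (hinc : MonotoneOn u₀ (Ici 0))
    (h1 : ∀ ξ, u₀ 0 ≤ u₀ ξ) (h2 : ∀ ξ, u₀ ξ ≤ 0) (T : ℝ)
    (hc : ∀ t, 0 ≤ t → t < T → 0 < 1 + t * u₀ 0) (Y : ℝ × ℝ → ℝ)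
    (hY : ∀ x t, 0 ≤ t → t < T → Y (x, t) * (1 + t * u₀ (Y (x, t))) ^ 2 = x)
    (x t : ℝ) (ht : 0 < t) (htT : t < T) :
    HasFDerivAt (fun p : ℝ × ℝ => (∫ z in (0:ℝ)..(Y p), u₀ z) + p.2 * Y p * u₀ (Y p) ^ 2)
      ((u₀ (Y (x, t)) / (1 + t * u₀ (Y (x, t)))) • ContinuousLinearMap.fst ℝ ℝ ℝ
        - (x * (u₀ (Y (x, t)) / (1 + t * u₀ (Y (x, t)))) ^ 2) • ContinuousLinearMap.snd ℝ ℝ ℝ)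
      (x, t) := by
  have hnhds : univ ×ˢ Ico 0 T ∈ nhds (x, t) :=
    prod_mem_nhds univ_mem (Ico_mem_nhds ht htT)
  have hYc : ContinuousAt Y (x, t) :=
    (bc_Y_cont u₀ hdec hinc h1 h2 T hc Y hY).continuousAt hnhds
  have hYx := hY x t ht.le htT
  have hct := hc t ht.le htT
  set ξ := Y (x, t) with hξ
  set a := u₀ ξ with ha
  have hs : 0 < 1 + t * a := by
    have := mul_le_mul_of_nonneg_left (h1 ξ) ht.le; linarith
  -- main part
  set M : ℝ × ℝ → ℝ := fun p => (∫ z in (0:ℝ)..ξ, u₀ z) + p.2 * ξ * a ^ 2 +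
    a / (1 + p.2 * a) * (p.1 - ξ * (1 + p.2 * a) ^ 2) with hM
  have hfst : HasFDerivAt (fun p : ℝ × ℝ => p.1) (ContinuousLinearMap.fst ℝ ℝ ℝ) (x, t) :=
    hasFDerivAt_fst
  have hsnd : HasFDerivAt (fun p : ℝ × ℝ => p.2) (ContinuousLinearMap.snd ℝ ℝ ℝ) (x, t) :=
    hasFDerivAt_snd
  have hMd : HasFDerivAt M ((a / (1 + t * a)) • ContinuousLinearMap.fst ℝ ℝ ℝ
        - (x * (a / (1 + t * a)) ^ 2) • ContinuousLinearMap.snd ℝ ℝ ℝ) (x, t) := by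
    have hsn : HasFDerivAt (fun p : ℝ × ℝ => 1 + p.2 * a) (a • ContinuousLinearMap.snd ℝ ℝ ℝ) (x, t) :=
      (hsnd.mul_const a).const_add 1
    have hinv : HasFDerivAt (fun p : ℝ × ℝ => (1 + p.2 * a)⁻¹)
        ((-((1 + t * a) ^ 2)⁻¹) • (a • ContinuousLinearMap.snd ℝ ℝ ℝ)) (x, t) :=
      (hasDerivAt_inv hs.ne').comp_hasFDerivAt (x, t) hsn
    have := (((hsnd.mul_const ξ).mul_const (a ^ 2)).const_add (∫ z in (0:ℝ)..ξ, u₀ z)).add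
      ((hinv.const_mul a).mul (hfst.sub ((hsn.pow 2).const_mul ξ)))
    refine (this.congr_fderiv ?_).congr_of_eventuallyEq (Eventually.of_forall fun p => ?_)
    · ext
      · simp; field_simp
      · simp; rw [← hYx]; have hsne := hs.ne'; rw [show 2 + 2 * (t * a) = 2 * (1 + t * a) by ring]; generalize 1 + t * a = s at hsne ⊢; field_simp; ring
    · simp [hM, div_eq_mul_inv]
  -- remainder
  have hDd : HasFDerivAt (fun p : ℝ × ℝ => p.1 - ξ * (1 + p.2 * a) ^ 2) 
      (ContinuousLinearMap.fst ℝ ℝ ℝ - ξ • ((2 • (1 + t * a)) • (a • ContinuousLinearMap.snd ℝ ℝ ℝ))) (x, t) := by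
    have hsn : HasFDerivAt (fun p : ℝ × ℝ => 1 + p.2 * a) (a • ContinuousLinearMap.snd ℝ ℝ ℝ) (x, t) :=
      (hsnd.mul_const a).const_add 1
    have := hfst.sub ((hsn.pow 2).const_mul ξ)
    refine (this.congr_fderiv (by simp)).congr_of_eventuallyEq (Eventually.of_forall fun p => rfl)
  have hO : (fun p : ℝ × ℝ => p.1 - ξ * (1 + p.2 * a) ^ 2) =O[nhds (x, t)] (fun p => p - (x, t)) := by
    have := hDd.isBigO_sub
    simpa [hYx] using this
  have hR : (fun p : ℝ × ℝ => ((∫ z in (0:ℝ)..(Y p), u₀ z) + p.2 * Y p * u₀ (Y p) ^ 2) - M p)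
      =o[nhds (x, t)] (fun p : ℝ × ℝ => p.1 - ξ * (1 + p.2 * a) ^ 2) := by
    rw [Asymptotics.isLittleO_iff]
    intro δ hδ
    set K : ℝ := 1 / (1 + t * u₀ 0) ^ 2 + 1 / (1 + t * u₀ 0) ^ 3 with hK
    have hK0 : 0 < K := by positivity
    have hKc : ContinuousAt (fun p : ℝ × ℝ => 1 / (1 + p.2 * u₀ 0) ^ 2 + 1 / (1 + p.2 * u₀ 0) ^ 3)
        (x, t) := by
      refine ContinuousAt.add ?_ ?_ <;>
      refine ContinuousAt.div (by fun_prop) (by fun_prop) ?_ <;> simp only <;> positivity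
    have hKe : ∀ᶠ p : ℝ × ℝ in nhds (x, t),
        1 / (1 + p.2 * u₀ 0) ^ 2 + 1 / (1 + p.2 * u₀ 0) ^ 3 < 2 * K :=
      hKc.eventually_lt_const (by simp only; rw [← hK]; linarith)
    obtain ⟨r, hr, hr2⟩ := Metric.continuousAt_iff.1 (hcont.continuousAt (x := ξ)) (δ / (2 * K))
      (by positivity)
    have hYe : ∀ᶠ p in nhds (x, t), Y p ∈ Metric.ball ξ r := hYc (Metric.ball_mem_nhds _ hr)
    filter_upwards [hKe, hYe, hnhds] with p hp1 hp2 hp3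
    obtain ⟨x', t'⟩ := p
    obtain ⟨-, ht0', htT'⟩ := hp3
    simp only at ht0' htT' hp1 ⊢
    have hct' := hc t' ht0' htT'
    have := bc_potential u₀ hcont hdec hinc h1 h2 t' ht0' hct' ξ (Y (x', t')) (δ / (2 * K))
      (fun z hz => by
        have hz' : z ∈ Metric.ball ξ r := by
          have hcv : Convex ℝ (Metric.ball ξ r) := convex_ball ξ r
          exact hcv.ordConnected.uIcc_subset (Metric.mem_ball_self hr) hp2 hz
        have := hr2 hz'
        rw [Real.dist_eq] at this
        exact this.le)
    rw [hY x' t' ht0' htT'] at this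
    rw [Real.norm_eq_abs, Real.norm_eq_abs]
    have e : (∫ z in (0:ℝ)..(Y (x', t')), u₀ z) + t' * Y (x', t') * u₀ (Y (x', t')) ^ 2 - M (x', t')
      = ((∫ z in (0:ℝ)..(Y (x', t')), u₀ z) + t' * Y (x', t') * u₀ (Y (x', t')) ^ 2) -
        ((∫ z in (0:ℝ)..ξ, u₀ z) + t' * ξ * u₀ ξ ^ 2) -
        u₀ ξ / (1 + t' * u₀ ξ) * (x' - ξ * (1 + t' * u₀ ξ) ^ 2) := by
      simp only [hM, ha]; ring
    rw [e]
    refine this.trans ?_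
    refine mul_le_mul_of_nonneg_right ?_ (abs_nonneg _)
    calc _ ≤ 2 * K * (δ / (2 * K)) := mul_le_mul_of_nonneg_right hp1.le (by positivity)
      _ = δ := by field_simp
  have hRd : HasFDerivAt (fun p : ℝ × ℝ => ((∫ z in (0:ℝ)..(Y p), u₀ z) + p.2 * Y p * u₀ (Y p) ^ 2) - M p)
      (0 : ℝ × ℝ →L[ℝ] ℝ) (x, t) := by
    rw [hasFDerivAt_iff_isLittleO]
    have := hR.trans_isBigO hO
    have e0 : M (x, t) = (∫ z in (0:ℝ)..ξ, u₀ z) + t * ξ * a ^ 2 := by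
      simp only [hM]; rw [hYx]; ring
    refine this.congr_left fun p => ?_
    simp [e0, ← hξ, ← ha]
  have := hRd.add hMd
  rw [zero_add] at this
  refine this.congr_of_eventuallyEq (Eventually.of_forall fun p => ?_)
  simp

lemma bc_green (W u v : ℝ × ℝ → ℝ) (T : ℝ) (hT : 0 < T)
    (hWc : ContinuousOn W (univ ×ˢ Ico 0 T)) (huc : ContinuousOn u (univ ×ˢ Ico 0 T))
    (hvc : ContinuousOn v (univ ×ˢ Ico 0 T))
    (hW : ∀ x t, 0 < t → t < T → HasFDerivAt W (u (x, t) • ContinuousLinearMap.fst ℝ ℝ ℝ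
        - v (x, t) • ContinuousLinearMap.snd ℝ ℝ ℝ) (x, t))
    (hW0 : ∀ x, HasDerivAt (fun x => W (x, 0)) (u (x, 0)) x)
    (φ : ℝ × ℝ → ℝ) (hφ : ContDiff ℝ (⊤ : ℕ∞) φ) (hφc : HasCompactSupport φ)
    (hφs : tsupport φ ⊆ univ ×ˢ Iio T) :
    (∫ t in Ioo (0 : ℝ) T, ∫ x : ℝ,
        (u (x, t) * fderiv ℝ φ (x, t) (0, 1) + v (x, t) * fderiv ℝ φ (x, t) (1, 0)))
      + ∫ x : ℝ, u (x, 0) * φ (x, 0) = 0 := by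
  -- box containing the support
  obtain ⟨R, hR0, hR⟩ : ∃ R : ℝ, 0 < R ∧ ∀ p ∈ tsupport φ, |p.1| < R := by
    obtain ⟨C, hC⟩ := (hφc.isCompact.image continuous_fst).isBounded.exists_norm_le
    refine ⟨|C| + 1, by positivity, fun p hp => ?_⟩
    have := hC p.1 (mem_image_of_mem _ hp)
    rw [Real.norm_eq_abs] at this
    linarith [le_abs_self C]
  obtain ⟨T', hT'0, hT'T, hT'⟩ : ∃ T' : ℝ, 0 < T' ∧ T' < T ∧ ∀ p ∈ tsupport φ, p.2 < T' := by
    have hK : IsCompact (insert 0 (Prod.snd '' tsupport φ)) :=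
      (hφc.isCompact.image continuous_snd).insert 0
    obtain ⟨m, hm, hmax⟩ := hK.exists_isGreatest ⟨0, mem_insert _ _⟩
    have hm0 : 0 ≤ m := hmax (mem_insert _ _)
    have hmT : m < T := by
      rcases hm with rfl | ⟨p, hp, rfl⟩
      · exact hT
      · exact (hφs hp).2
    refine ⟨(m + T) / 2, by linarith, by linarith, fun p hp => ?_⟩
    have := hmax (mem_insert_of_mem _ (mem_image_of_mem Prod.snd hp))
    linarith
  have hd0 : ∀ x t, (R ≤ |x| ∨ T' ≤ t) → fderiv ℝ φ (x, t) = 0 := by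
    intro x t h
    apply fderiv_of_notMem_tsupport
    intro hp
    rcases h with h | h
    · exact absurd (hR _ hp) (not_lt.2 h)
    · exact absurd (hT' _ hp) (not_lt.2 h)
  have hφ0 : ∀ x t, (R ≤ |x| ∨ T' ≤ t) → φ (x, t) = 0 := by
    intro x t h
    apply image_eq_zero_of_notMem_tsupport
    intro hp
    rcases h with h | h
    · exact absurd (hR _ hp) (not_lt.2 h)
    · exact absurd (hT' _ hp) (not_lt.2 h)
  have habsR : |R| = R := abs_of_pos hR0
  have habsR' : |-R| = R := by rw [abs_neg, habsR]
  have hsupp : ∀ f : ℝ → ℝ, (∀ x, R ≤ |x| → f x = 0) → ∫ x, f x = ∫ x in (-R)..R, f x := by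
    intro f hf
    rw [intervalIntegral.integral_eq_integral_of_support_subset]
    intro x hx
    by_contra h
    apply hx
    apply hf
    by_contra h'
    rw [not_le, abs_lt] at h'
    exact h ⟨h'.1, h'.2.le⟩
  have hdφ : ContDiff ℝ 1 (fderiv ℝ φ) := hφ.fderiv_right (by norm_cast)
  have hdd : ∀ p w, HasFDerivAt (fun q => fderiv ℝ φ q w) ((fderiv ℝ (fderiv ℝ φ) p).flip w) p := by
    intro p w
    have := ((hdφ.differentiable (by norm_num)) p).hasFDerivAt.clm_apply (hasFDerivAt_const w p)
    simpa using this
  have hsymm : ∀ p v w, fderiv ℝ (fderiv ℝ φ) p v w = fderiv ℝ (fderiv ℝ φ) p w v := by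
    intro p v w
    exact (hφ.contDiffAt.isSymmSndFDerivAt (by simp; norm_cast)) v w
  have hdc : ∀ w, Continuous (fun q => fderiv ℝ φ q w) := fun w =>
    hdφ.continuous.clm_apply continuous_const
  set box : Set (ℝ × ℝ) := uIcc (-R) R ×ˢ uIcc 0 T' with hbox
  have hsub : box ⊆ univ ×ˢ Ico 0 T := by
    rintro p ⟨-, hp⟩
    rw [uIcc_of_le hT'0.le] at hp
    exact ⟨mem_univ _, hp.1, hp.2.trans_lt hT'T⟩
  have hGc : ContinuousOn (fun p : ℝ × ℝ => u p * fderiv ℝ φ p (0, 1) + v p * fderiv ℝ φ p (1, 0)) box :=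
    ((huc.mono hsub).mul (hdc _).continuousOn).add ((hvc.mono hsub).mul (hdc _).continuousOn)
  have hGi : IntegrableOn (fun p : ℝ × ℝ => u p * fderiv ℝ φ p (0, 1) + v p * fderiv ℝ φ p (1, 0)) box :=
    hGc.integrableOn_compact (isCompact_uIcc.prod isCompact_uIcc)
  -- reduce to the box
  have e1 : (∫ t in Ioo (0 : ℝ) T, ∫ x : ℝ,
        (u (x, t) * fderiv ℝ φ (x, t) (0, 1) + v (x, t) * fderiv ℝ φ (x, t) (1, 0)))
      = ∫ x in (-R)..R, ∫ t in (0:ℝ)..T',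
        (u (x, t) * fderiv ℝ φ (x, t) (0, 1) + v (x, t) * fderiv ℝ φ (x, t) (1, 0)) := by
    rw [intervalIntegral_intervalIntegral_swap
      (F := fun x t => (u (x, t) * fderiv ℝ φ (x, t) (0, 1) + v (x, t) * fderiv ℝ φ (x, t) (1, 0)))
      (hGi.mono_set (prod_mono uIoc_subset_uIcc uIoc_subset_uIcc)),
      intervalIntegral.integral_of_le hT'0.le]
    have hsub2 : Ioc 0 T' ⊆ Ioo 0 T := fun t ht => ⟨ht.1, ht.2.trans_lt hT'T⟩
    rw [setIntegral_eq_of_subset_of_forall_sdiff_eq_zero measurableSet_Ioo hsub2]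
    · refine setIntegral_congr_fun measurableSet_Ioc fun t ht => ?_
      exact hsupp _ fun x hx => by simp [hd0 x t (Or.inl hx)]
    · rintro t ⟨ht1, ht2⟩
      have : T' ≤ t := by
        by_contra h
        exact ht2 ⟨ht1.1, (not_le.1 h).le⟩
      simp [hd0 _ t (Or.inr this)]
  have hdiv := integral2_divergence_prod_of_hasFDerivAt
    (fun p => W p * fderiv ℝ φ p (0, 1)) (fun p => -(W p * fderiv ℝ φ p (1, 0)))
    (fun p => W p • ((fderiv ℝ (fderiv ℝ φ) p).flip (0, 1)) +
      fderiv ℝ φ p (0, 1) • (u p • ContinuousLinearMap.fst ℝ ℝ ℝ - v p • ContinuousLinearMap.snd ℝ ℝ ℝ))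
    (fun p => -(W p • ((fderiv ℝ (fderiv ℝ φ) p).flip (1, 0)) +
      fderiv ℝ φ p (1, 0) • (u p • ContinuousLinearMap.fst ℝ ℝ ℝ - v p • ContinuousLinearMap.snd ℝ ℝ ℝ)))
    (-R) 0 R T' ((hWc.mono hsub).mul (hdc _).continuousOn)
    ((hWc.mono hsub).mul (hdc _).continuousOn).neg
    (by
      rintro ⟨x, t⟩ ⟨-, ht⟩
      rw [min_eq_left hT'0.le, max_eq_right hT'0.le] at ht
      exact (hW x t ht.1 (ht.2.trans hT'T)).mul (hdd _ _))
    (by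
      rintro ⟨x, t⟩ ⟨-, ht⟩
      rw [min_eq_left hT'0.le, max_eq_right hT'0.le] at ht
      exact ((hW x t ht.1 (ht.2.trans hT'T)).mul (hdd _ _)).neg)
    (by
      refine hGi.congr_fun (fun p _ => ?_) (measurableSet_uIcc.prod measurableSet_uIcc)
      simp [hsymm p (1, 0) (0, 1)]
      ring)
  have e2 : ∀ x t, (u (x, t) * fderiv ℝ φ (x, t) (0, 1) + v (x, t) * fderiv ℝ φ (x, t) (1, 0))
     = (W (x, t) • ((fderiv ℝ (fderiv ℝ φ) (x, t)).flip (0, 1)) +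
      fderiv ℝ φ (x, t) (0, 1) • (u (x, t) • ContinuousLinearMap.fst ℝ ℝ ℝ - v (x, t) • ContinuousLinearMap.snd ℝ ℝ ℝ)) (1, 0) +
      (-(W (x, t) • ((fderiv ℝ (fderiv ℝ φ) (x, t)).flip (1, 0)) +
      fderiv ℝ φ (x, t) (1, 0) • (u (x, t) • ContinuousLinearMap.fst ℝ ℝ ℝ - v (x, t) • ContinuousLinearMap.snd ℝ ℝ ℝ))) (0, 1) := by
    intro x t
    simp [hsymm (x, t) (1, 0) (0, 1)]
    ring
  have e3 : ∫ x : ℝ, u (x, 0) * φ (x, 0) = ∫ x in (-R)..R, u (x, 0) * φ (x, 0) :=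
    hsupp _ fun x hx => by simp [hφ0 x 0 (Or.inl hx)]
  have hφ1 : ∀ x, HasDerivAt (fun x => φ (x, 0)) (fderiv ℝ φ (x, 0) (1, 0)) x := by
    intro x
    have h := ((hφ.differentiable (by simp)) (x, 0)).hasFDerivAt
    have h2 : HasDerivAt (fun x : ℝ => (x, (0:ℝ))) (1, 0) x :=
      (hasDerivAt_id x).prodMk (hasDerivAt_const x 0)
    exact h.comp_hasDerivAt x h2
  have hu0c : Continuous fun x => u (x, 0) := by
    refine huc.comp_continuous (by fun_prop) fun x => ⟨mem_univ _, le_rfl, hT⟩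
  have e4 := intervalIntegral.integral_mul_deriv_eq_deriv_mul (a := -R) (b := R)
    (fun x _ => hW0 x) (fun x _ => hφ1 x) (hu0c.intervalIntegrable _ _)
    (((hdc (1, 0)).comp (by fun_prop : Continuous fun x : ℝ => (x, (0:ℝ)))).intervalIntegrable _ _)
  rw [e1, e3]
  simp only [e2]
  rw [hdiv]
  simp only [hd0 R _ (Or.inl habsR.ge), hd0 (-R) _ (Or.inl habsR'.ge), hd0 _ T' (Or.inr le_rfl)]
  rw [hφ0 R _ (Or.inl habsR.ge), hφ0 (-R) _ (Or.inl habsR'.ge)] at e4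
  simp
  simp at e4
  linarith

/-- for bounded continuous monotone-well data with `u₀ 0 < 0`, there is a
continuous solution on `ℝ × [0, T*)`, `T* = −1/u₀(0)`, which follows the characteristics,
whose sup-norm at time `t` is `−u₀(0)/(1 + t u₀(0))`, and which blows up in `L^∞`
as `t → T*⁻`. -/
theorem statement0 (u₀ : ℝ → ℝ) (hcont : Continuous u₀)
    (hbdd : ∃ M : ℝ, ∀ x, |u₀ x| ≤ M)
    (hdec : AntitoneOn u₀ (Iic 0)) (hinc : MonotoneOn u₀ (Ici 0))
    (hneg : u₀ 0 < 0)
    (hlim : Tendsto u₀ (cocompact ℝ) (nhds 0))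
    (Tstar : ℝ) (hT : Tstar = -1 / u₀ 0) :
    ∃ u : ℝ × ℝ → ℝ,
      ContinuousOn u (univ ×ˢ Ico 0 Tstar) ∧
      (∀ x : ℝ, u (x, 0) = u₀ x) ∧
      IsWeakSolution Tstar u u₀ ∧
      (∀ ξ t : ℝ, 0 ≤ t → t < Tstar →
        u (ξ * (1 + t * u₀ ξ) ^ 2, t) = u₀ ξ / (1 + t * u₀ ξ)) ∧
      (∀ t : ℝ, 0 ≤ t → t < Tstar →
        (⨆ x : ℝ, |u (x, t)|) = -u₀ 0 / (1 + t * u₀ 0)) ∧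
      Tendsto (fun t => ⨆ x : ℝ, |u (x, t)|) (nhdsWithin Tstar (Iio Tstar)) atTop := by
  have h1 : ∀ ξ, u₀ 0 ≤ u₀ ξ := fun ξ => by
    rcases le_total 0 ξ with h | h
    · exact hinc (mem_Ici.2 le_rfl) h h
    · exact hdec h (mem_Iic.2 le_rfl) h
  have h2 : ∀ ξ, u₀ ξ ≤ 0 := fun ξ => by
    rcases le_total 0 ξ with h | h
    · have hl : Tendsto u₀ atTop (nhds 0) := hlim.mono_left atTop_le_cocompact
      refine ge_of_tendsto hl ?_
      filter_upwards [eventually_ge_atTop ξ] with y hy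
      exact hinc h (h.trans hy) hy
    · have hl : Tendsto u₀ atBot (nhds 0) := hlim.mono_left atBot_le_cocompact
      refine ge_of_tendsto hl ?_
      filter_upwards [eventually_le_atBot ξ] with y hy
      exact hdec (mem_Iic.2 (hy.trans h)) h hy
  have hT0 : 0 < Tstar := by rw [hT]; exact div_pos_of_neg_of_neg (by norm_num) hneg
  have hTu : Tstar * u₀ 0 = -1 := by rw [hT]; exact div_mul_cancel₀ _ hneg.ne
  have hc : ∀ t, 0 ≤ t → t < Tstar → 0 < 1 + t * u₀ 0 := fun t _ ht => by
    have := mul_lt_mul_of_neg_right ht hneg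
    linarith
  have hcξ : ∀ t ξ, 0 ≤ t → t < Tstar → 1 + t * u₀ 0 ≤ 1 + t * u₀ ξ := fun t ξ h0 ht => by
    have := mul_le_mul_of_nonneg_left (h1 ξ) h0
    linarith
  have hex : ∀ p : ℝ × ℝ, ∃ ξ, 0 ≤ p.2 → p.2 < Tstar → ξ * (1 + p.2 * u₀ ξ) ^ 2 = p.1 := by
    intro p
    by_cases hp : 0 ≤ p.2 ∧ p.2 < Tstar
    · obtain ⟨ξ, hξ⟩ := bc_exists_inv u₀ hcont h1 p.2 hp.1 (hc _ hp.1 hp.2) p.1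
      exact ⟨ξ, fun _ _ => hξ⟩
    · exact ⟨0, fun a b => absurd ⟨a, b⟩ hp⟩
  choose Y hY' using hex
  have hY : ∀ x t, 0 ≤ t → t < Tstar → Y (x, t) * (1 + t * u₀ (Y (x, t))) ^ 2 = x :=
    fun x t h0 ht => hY' (x, t) h0 ht
  have hYX : ∀ ξ t, 0 ≤ t → t < Tstar → Y (ξ * (1 + t * u₀ ξ) ^ 2, t) = ξ := by
    intro ξ t h0 ht
    have h := bc_expand_abs u₀ hdec hinc h1 h2 t h0 (hc t h0 ht) ξ (Y (ξ * (1 + t * u₀ ξ) ^ 2, t))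
    rw [hY _ t h0 ht, sub_self, abs_zero] at h
    have hp : 0 < (1 + t * u₀ 0) ^ 2 := by have := hc t h0 ht; positivity
    have : |Y (ξ * (1 + t * u₀ ξ) ^ 2, t) - ξ| ≤ 0 := by
      by_contra hh
      push Not at hh
      have := mul_pos hp hh
      linarith
    have := abs_nonpos_iff.1 this
    linarith
  have hYc := bc_Y_cont u₀ hdec hinc h1 h2 Tstar hc Y hY
  have hu0Y : ContinuousOn (fun p => u₀ (Y p)) (univ ×ˢ Ico 0 Tstar) := hcont.comp_continuousOn hYc
  set u : ℝ × ℝ → ℝ := fun p => u₀ (Y p) / (1 + p.2 * u₀ (Y p)) with hu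
  have hucont : ContinuousOn u (univ ×ˢ Ico 0 Tstar) := by
    refine hu0Y.div (continuousOn_const.add (continuousOn_snd.mul hu0Y)) ?_
    rintro ⟨x, t⟩ ⟨-, h0, ht⟩
    exact ((hc t h0 ht).trans_le (hcξ t _ h0 ht)).ne'
  have hvcont : ContinuousOn (fun p : ℝ × ℝ => p.1 * u p ^ 2) (univ ×ˢ Ico 0 Tstar) :=
    continuousOn_fst.mul (hucont.pow 2)
  have hY0 : ∀ x, Y (x, 0) = x := fun x => by
    have := hY x 0 le_rfl hT0
    simpa using this
  have hu0 : ∀ x, u (x, 0) = u₀ x := fun x => by simp [hu, hY0]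
  have hchar : ∀ ξ t : ℝ, 0 ≤ t → t < Tstar →
        u (ξ * (1 + t * u₀ ξ) ^ 2, t) = u₀ ξ / (1 + t * u₀ ξ) := by
    intro ξ t h0 ht
    simp only [hu]
    rw [hYX ξ t h0 ht]
  have hsup : ∀ t : ℝ, 0 ≤ t → t < Tstar →
        (⨆ x : ℝ, |u (x, t)|) = -u₀ 0 / (1 + t * u₀ 0) := by
    intro t h0 ht
    have hle : ∀ x, |u (x, t)| ≤ -u₀ 0 / (1 + t * u₀ 0) := by
      intro x
      have a1 := hc t h0 ht
      have a2 := hcξ t (Y (x, t)) h0 ht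
      simp only [hu]
      rw [abs_div, abs_of_nonpos (h2 _), abs_of_pos (a1.trans_le a2)]
      have := h1 (Y (x, t))
      have := h2 0
      gcongr
      linarith
    have h00 : |u (0, t)| = -u₀ 0 / (1 + t * u₀ 0) := by
      have := hchar 0 t h0 ht
      rw [zero_mul] at this
      rw [this, abs_div, abs_of_nonpos (h2 _), abs_of_pos (hc t h0 ht)]
    refine le_antisymm (ciSup_le hle) ?_
    rw [← h00]
    exact le_ciSup (f := fun x => |u (x, t)|) ⟨_, by rintro _ ⟨x, rfl⟩; exact hle x⟩ 0
  have hsubset : (univ ×ˢ Ioo 0 Tstar : Set (ℝ × ℝ)) ⊆ univ ×ˢ Ico 0 Tstar :=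
    prod_mono le_rfl Ioo_subset_Ico_self
  have hmeas : MeasurableSet (univ ×ˢ Ioo 0 Tstar : Set (ℝ × ℝ)) :=
    MeasurableSet.univ.prod measurableSet_Ioo
  refine ⟨u, hucont, hu0, ⟨(hucont.mono hsubset).locallyIntegrableOn hmeas,
    (hvcont.mono hsubset).locallyIntegrableOn hmeas, ?_⟩, hchar, hsup, ?_⟩
  · intro φ hφ hφc hφs
    have hPc : Continuous fun y : ℝ => ∫ z in (0:ℝ)..y, u₀ z :=
      intervalIntegral.continuous_primitive (fun _ _ => hcont.intervalIntegrable _ _) 0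
    have := bc_green
      (fun p : ℝ × ℝ => (∫ z in (0:ℝ)..(Y p), u₀ z) + p.2 * Y p * u₀ (Y p) ^ 2)
      u (fun p => p.1 * u p ^ 2) Tstar hT0
      ((hPc.comp_continuousOn hYc).add ((continuousOn_snd.mul hYc).mul (hu0Y.pow 2)))
      hucont hvcont
      (fun x t h0 ht => bc_fderiv u₀ hcont hdec hinc h1 h2 Tstar hc Y hY x t h0 ht)
      (fun x => by
        simp only [hY0, hu0, zero_mul, add_zero]
        exact intervalIntegral.integral_hasDerivAt_right (hcont.intervalIntegrable _ _)
          (hcont.stronglyMeasurableAtFilter _ _) hcont.continuousAt)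
      φ hφ hφc hφs
    simpa only [hu0] using this
  · have hev : (fun t => -u₀ 0 / (1 + t * u₀ 0)) =ᶠ[nhdsWithin Tstar (Iio Tstar)]
        (fun t => ⨆ x : ℝ, |u (x, t)|) := by
      filter_upwards [Ioo_mem_nhdsLT hT0] with t ht
      exact (hsup t ht.1.le ht.2).symm
    refine Tendsto.congr' hev ?_
    have hz : Tendsto (fun t => 1 + t * u₀ 0) (nhdsWithin Tstar (Iio Tstar)) (nhdsWithin 0 (Ioi 0)) := by
      rw [tendsto_nhdsWithin_iff]
      constructor
      · have : ContinuousAt (fun t => 1 + t * u₀ 0) Tstar := by fun_prop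
        have := this.tendsto
        rw [hTu] at this
        norm_num at this
        exact this.mono_left nhdsWithin_le_nhds
      · filter_upwards [Ioo_mem_nhdsLT hT0] with t ht
        exact hc t ht.1.le ht.2
    simp only [div_eq_mul_inv]
    exact (tendsto_inv_nhdsGT_zero.comp hz).const_mul_atTop (by linarith)
end

section
/- Let u₀(x) = −1/√(−x) for x < 0 and u₀(x) = 0 for x ≥ 0. For each λ ≥ 0 define u_λ : ℝ × (0,∞) → ℝ by u_λ(x,t) = −1/√(−x) if x < 0; u_λ(x,t) = 1/√x if 0 < x < (max(t−λ,0))²/4; and u_λ(x,t) = 0 otherwise. Then: (i) for every λ ≥ 0, u_λ satisfies the Kružkov entropy inequality for the flux f(x,u) = x·u² with initial datum u₀; (ii) for every λ ≥ 0, ∫_ℝ |u_λ(x,t) − u₀(x)| dx → 0 as t → 0⁺ (so each u_λ is continuous in time at t = 0 with respect to the L¹ norm); (iii) if λ ≠ μ then u_λ and u_μ differ on a set of positive Lebesgue measure in ℝ × (0,∞). In particular, the Cauchy problem for u_t + (x u²)_x = 0 with initial datum u₀ admits infinitely many Kružkov entropy solutions. -/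
open MeasureTheory Set Filter

/-- The sign function: `1` for `s ≥ 0`, `−1` for `s < 0`. -/
noncomputable def sgn (s : ℝ) : ℝ := if 0 ≤ s then 1 else -1

/-- The initial datum `u₀(x) = −1/√(−x)` for `x < 0`, `0` for `x ≥ 0`. -/
noncomputable def uInit (x : ℝ) : ℝ := if x < 0 then -1 / Real.sqrt (-x) else 0

/-- The family of candidate solutions `u_λ`, written at points `(x, t)`. -/
noncomputable def uFam (lam : ℝ) (p : ℝ × ℝ) : ℝ :=
  if p.1 < 0 then -1 / Real.sqrt (-p.1)
  else if 0 < p.1 ∧ p.1 < (max (p.2 - lam) 0) ^ 2 / 4 then 1 / Real.sqrt p.1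
  else 0

/-- `u` satisfies the Kružkov entropy inequality for the flux `f(x,u) = x u²`
with initial datum `w₀`. -/
def EntropySol (u : ℝ × ℝ → ℝ) (w₀ : ℝ → ℝ) : Prop :=
  ∀ (k : ℝ) (φ : ℝ × ℝ → ℝ), ContDiff ℝ (⊤ : ℕ∞) φ → HasCompactSupport φ →
    (∀ p, 0 ≤ φ p) →
    0 ≤ (∫ t in Ioi (0 : ℝ), ∫ x : ℝ,
          (|u (x, t) - k| * fderiv ℝ φ (x, t) (0, 1)
            + sgn (u (x, t) - k) * (x * (u (x, t)) ^ 2 - x * k ^ 2)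
                * fderiv ℝ φ (x, t) (1, 0)
            - sgn (u (x, t) - k) * k ^ 2 * φ (x, t)))
        + ∫ x : ℝ, |w₀ x - k| * φ (x, 0)


lemma uFam_neg {lam x t : ℝ} (hx : x < 0) : uFam lam (x, t) = -1 / Real.sqrt (-x) := by
  simp [uFam, hx]

lemma uFam_mid {lam x t : ℝ} (hx : 0 < x) (h : x < (max (t - lam) 0) ^ 2 / 4) :
    uFam lam (x, t) = 1 / Real.sqrt x := by
  unfold uFam
  rw [if_neg (by simpa using hx.le), if_pos ⟨hx, h⟩]

lemma uFam_far {lam x t : ℝ} (hx : 0 ≤ x) (h : (max (t - lam) 0) ^ 2 / 4 ≤ x) :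
    uFam lam (x, t) = 0 := by
  unfold uFam
  rw [if_neg (by simpa using hx), if_neg (by simpa using fun _ => h)]

lemma front_iff {lam x t : ℝ} (hx : 0 < x) :
    x < (max (t - lam) 0) ^ 2 / 4 ↔ lam + 2 * Real.sqrt x < t := by
  have hs : 0 < Real.sqrt x := Real.sqrt_pos.2 hx
  have hsq : Real.sqrt x ^ 2 = x := Real.sq_sqrt hx.le
  constructor
  · intro h
    by_contra hc
    push Not at hc
    have h1 : max (t - lam) 0 ≤ 2 * Real.sqrt x := max_le (by linarith) (by positivity)
    have h0 : 0 ≤ max (t - lam) 0 := le_max_right _ _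
    nlinarith
  · intro h
    rw [max_eq_left (by linarith)]
    nlinarith

lemma measurable_uFam (lam : ℝ) : Measurable (uFam lam) := by
  unfold uFam
  refine Measurable.ite (measurableSet_lt (by fun_prop) (by fun_prop)) (by fun_prop) ?_
  refine Measurable.ite ?_ (by fun_prop) (by fun_prop)
  have h1 : MeasurableSet {p : ℝ × ℝ | 0 < p.1} := measurableSet_lt (by fun_prop) (by fun_prop)
  have h2 : MeasurableSet {p : ℝ × ℝ | p.1 < (max (p.2 - lam) 0) ^ 2 / 4} :=
    measurableSet_lt (by fun_prop) (by fun_prop)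
  exact h1.inter h2

lemma measurable_sgn : Measurable sgn := by
  unfold sgn
  exact Measurable.ite (measurableSet_le (by fun_prop) (by fun_prop)) (by fun_prop) (by fun_prop)

lemma abs_sgn (s : ℝ) : |sgn s| = 1 := by
  unfold sgn; split_ifs <;> simp

lemma abs_uFam_le (lam x t : ℝ) : |uFam lam (x, t)| ≤ 1 / Real.sqrt |x| := by
  rcases lt_trichotomy x 0 with h | h | h
  · rw [uFam_neg h, abs_div, abs_neg, abs_one, abs_of_nonneg (Real.sqrt_nonneg _), abs_of_neg h]
  · subst h; simp [uFam]
  · by_cases h2 : x < (max (t - lam) 0) ^ 2 / 4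
    · rw [uFam_mid h h2, abs_div, abs_one, abs_of_nonneg (Real.sqrt_nonneg _), abs_of_pos h]
    · rw [uFam_far h.le (not_lt.1 h2), abs_zero]; positivity

lemma abs_x_uFam_sq_le (lam x t : ℝ) : |x * uFam lam (x, t) ^ 2| ≤ 1 := by
  have h := abs_uFam_le lam x t
  rw [abs_mul, abs_pow]
  have h2 : |uFam lam (x, t)| ^ 2 ≤ (1 / Real.sqrt |x|) ^ 2 := by gcongr
  rw [div_pow, Real.sq_sqrt (abs_nonneg x)] at h2
  calc |x| * |uFam lam (x, t)| ^ 2 ≤ |x| * (1 ^ 2 / |x|) := by gcongr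
    _ ≤ 1 := by
      rcases eq_or_ne x 0 with rfl | hx
      · simp
      · have : |x| ≠ 0 := abs_ne_zero.2 hx
        field_simp; norm_num

lemma uFam_zero_eq {lam : ℝ} (hl : 0 ≤ lam) (x : ℝ) : uFam lam (x, 0) = uInit x := by
  by_cases hx : x < 0
  · rw [uFam_neg hx]; simp [uInit, hx]
  · rw [uFam_far (not_lt.1 hx)]
    · simp [uInit, hx]
    · rw [max_eq_right (by linarith)]; simpa using hx

lemma invsqrt_Ioc (M : ℝ) (hM : 0 ≤ M) : IntervalIntegrable (fun x : ℝ => 1 / Real.sqrt |x|) volume 0 M := by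
  have h := intervalIntegral.intervalIntegrable_rpow' (a := 0) (b := M) (r := -(1/2)) (by norm_num)
  refine h.congr ?_
  intro x hx
  rw [uIoc_of_le hM] at hx
  simp only
  rw [abs_of_pos hx.1, Real.rpow_neg hx.1.le, ← Real.sqrt_eq_rpow, one_div]

lemma invsqrt_int (M : ℝ) (hM : 0 ≤ M) :
    IntegrableOn (fun x : ℝ => 1 / Real.sqrt |x|) (Icc (-M) M) := by
  have h1 := invsqrt_Ioc M hM
  have h2 : IntervalIntegrable (fun x : ℝ => 1 / Real.sqrt |x|) volume (-M) 0 := by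
    rw [IntervalIntegrable.iff_comp_neg]
    simpa using h1.symm
  have h3 := h2.trans h1
  rw [intervalIntegrable_iff_integrableOn_Icc_of_le (by linarith)] at h3
  exact h3

lemma part_ii (lam : ℝ) (hl : 0 ≤ lam) :
    Tendsto (fun t => ∫ x : ℝ, |uFam lam (x, t) - uInit x|)
        (nhdsWithin 0 (Ioi 0)) (nhds 0) := by
  have key : ∀ t, ∫ x : ℝ, |uFam lam (x, t) - uInit x| = max (t - lam) 0 := by
    intro t
    set s := max (t - lam) 0 with hs
    have hs0 : 0 ≤ s := le_max_right _ _
    have hR : (0 : ℝ) ≤ s ^ 2 / 4 := by positivity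
    have e : (fun x : ℝ => |uFam lam (x, t) - uInit x|)
        = indicator (Ioo 0 (s ^ 2 / 4)) (fun x => x ^ (-(1/2) : ℝ)) := by
      ext x
      by_cases hx : x < 0
      · rw [uFam_neg hx, indicator_of_notMem (by simp [hx.le])]
        simp [uInit, hx]
      · have hx' := not_lt.1 hx
        by_cases h2 : 0 < x ∧ x < s ^ 2 / 4
        · rw [uFam_mid h2.1 h2.2, indicator_of_mem (by exact h2)]
          simp only [uInit, if_neg hx, sub_zero]
          rw [Real.rpow_neg hx', ← Real.sqrt_eq_rpow, one_div, abs_of_nonneg (by positivity)]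
        · rw [indicator_of_notMem (by exact h2)]
          simp [uFam, uInit, hx, ← hs, h2]
    rw [e, integral_indicator measurableSet_Ioo, ← integral_Ioc_eq_integral_Ioo,
      ← intervalIntegral.integral_of_le hR, integral_rpow (Or.inl (by norm_num))]
    have : (-(1/2) + 1 : ℝ) = 1/2 := by norm_num
    rw [this, ← Real.sqrt_eq_rpow, Real.zero_rpow (by norm_num)]
    have h4 : s ^ 2 / 4 = (s / 2) ^ 2 := by ring
    rw [h4, Real.sqrt_sq (by positivity)]
    ring
  simp_rw [key]
  have hc : Continuous (fun t : ℝ => max (t - lam) 0) := by fun_prop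
  have := (hc.tendsto 0).mono_left (nhdsWithin_le_nhds (s := Ioi 0))
  simpa [hl] using this

lemma part_iii_aux (lam mu : ℝ) (hl : 0 ≤ lam) (h : lam < mu) :
      0 < volume {p : ℝ × ℝ | 0 < p.2 ∧ uFam lam p ≠ uFam mu p} := by
  let U : Set (ℝ × ℝ) := {p | 0 < p.1 ∧ lam < p.2 ∧ p.2 < mu ∧ p.1 < (p.2 - lam) ^ 2 / 4}
  have hU : IsOpen U := by
    have h1 : IsOpen {p : ℝ × ℝ | 0 < p.1} := isOpen_lt (by fun_prop) (by fun_prop)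
    have h2 : IsOpen {p : ℝ × ℝ | lam < p.2} := isOpen_lt (by fun_prop) (by fun_prop)
    have h3 : IsOpen {p : ℝ × ℝ | p.2 < mu} := isOpen_lt (by fun_prop) (by fun_prop)
    have h4 : IsOpen {p : ℝ × ℝ | p.1 < (p.2 - lam) ^ 2 / 4} :=
      isOpen_lt (by fun_prop) (by fun_prop)
    exact h1.inter (h2.inter (h3.inter h4))
  have hne : U.Nonempty := by
    refine ⟨(((mu - lam) / 2) ^ 2 / 8, (lam + mu) / 2), ?_, ?_, ?_, ?_⟩ <;> simp only
    · have : 0 < mu - lam := by linarith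
      positivity
    · linarith
    · linarith
    · nlinarith
  refine (hU.measure_pos volume hne).trans_le (measure_mono ?_)
  rintro ⟨x, t⟩ ⟨h1, h2, h3, h4⟩
  simp only at h1 h2 h3 h4
  refine ⟨by simp only; linarith, ?_⟩
  rw [uFam_mid h1 (by rwa [max_eq_left (by linarith)]), uFam_far h1.le]
  · have := Real.sqrt_pos.2 h1
    positivity
  · rw [max_eq_right (by linarith)]; simpa using h1.le

lemma part_iii (lam mu : ℝ) (hl : 0 ≤ lam) (hm : 0 ≤ mu) (h : lam ≠ mu) :
      0 < volume {p : ℝ × ℝ | 0 < p.2 ∧ uFam lam p ≠ uFam mu p} := by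
  rcases lt_or_gt_of_ne h with h | h
  · exact part_iii_aux lam mu hl h
  · simp_rw [ne_comm (a := uFam lam _)]
    exact part_iii_aux mu lam hm h

lemma sgn_of_pos {s : ℝ} (h : 0 < s) : sgn s = 1 := by simp [sgn, h.le]

lemma sgn_of_neg {s : ℝ} (h : s < 0) : sgn s = -1 := by simp [sgn, h]

lemma hasDerivAt_abs_affine (c x : ℝ) (σ : ℝ) (hσ : σ = 1 ∨ σ = -1)
    (h : 0 < σ * (1 + x * c)) :
    HasDerivAt (fun y : ℝ => |1 + y * c|) (σ * c) x := by
  have hd : HasDerivAt (fun y : ℝ => σ * (1 + y * c)) (σ * (1 * c)) x :=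
    (((hasDerivAt_id x).mul_const c).const_add 1).const_mul σ
  rw [one_mul] at hd
  refine hd.congr_of_eventuallyEq ?_
  have hc : Continuous (fun y : ℝ => σ * (1 + y * c)) := by fun_prop
  filter_upwards [hc.continuousAt.eventually (lt_mem_nhds h)] with y hy
  rcases hσ with rfl | rfl
  · rw [abs_of_pos (by linarith)]; ring
  · rw [abs_of_neg (by linarith)]; ring

lemma left_flux (k : ℝ) : ∃ q : ℝ → ℝ, Continuous q ∧ q 0 = 1 ∧
    ∀ x < 0, x ∉ ({-1 / k ^ 2} : Set ℝ) →
      q x = sgn (-1 / Real.sqrt (-x) - k) * (x * (-1 / Real.sqrt (-x)) ^ 2 - x * k ^ 2) ∧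
      HasDerivAt q (-(sgn (-1 / Real.sqrt (-x) - k) * k ^ 2)) x := by
  have pre : ∀ x : ℝ, x < 0 → ∃ s, 0 < s ∧ Real.sqrt (-x) = s ∧ x = - s ^ 2 ∧
      x * (-1 / Real.sqrt (-x)) ^ 2 = -1 := by
    intro x hx
    have h0 : 0 < Real.sqrt (-x) := Real.sqrt_pos.2 (by linarith)
    have h1 : Real.sqrt (-x) ^ 2 = -x := Real.sq_sqrt (by linarith)
    refine ⟨_, h0, rfl, by linarith, ?_⟩
    rw [div_pow, h1]
    have hx0 : x ≠ 0 := hx.ne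
    field_simp
  by_cases hk : 0 ≤ k
  · refine ⟨fun x => 1 + x * k ^ 2, by fun_prop, by simp, ?_⟩
    intro x hx _
    obtain ⟨s, hs, h1, h2, h3⟩ := pre x hx
    have h4 : sgn (-1 / Real.sqrt (-x) - k) = -1 := by
      apply sgn_of_neg
      rw [h1]
      have : 0 < 1 / s := by positivity
      have e : -1 / s = -(1 / s) := by ring
      rw [e]; linarith
    rw [h3, h4]
    refine ⟨by ring, ?_⟩
    have := ((hasDerivAt_id x).mul_const (k ^ 2)).const_add 1
    simpa using this
  · push Not at hk
    refine ⟨fun x => |1 + x * k ^ 2|, by fun_prop, by simp, ?_⟩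
    intro x hx hne
    obtain ⟨s, hs, h1, h2, h3⟩ := pre x hx
    have hk2 : 0 < k ^ 2 := by nlinarith
    have hne' : 1 + x * k ^ 2 ≠ 0 := by
      intro h
      apply hne
      rw [mem_singleton_iff, eq_div_iff hk2.ne']
      linarith
    have h5 : -1 / s - k = (-1 - k * s) / s := by field_simp
    rcases lt_or_gt_of_ne hne' with h | h
    · have h4 : sgn (-1 / Real.sqrt (-x) - k) = 1 := by
        apply sgn_of_pos
        rw [h1, h5]
        apply div_pos _ hs
        rw [h2] at h
        nlinarith [mul_pos (neg_pos.2 hk) hs]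
      rw [h3, h4]
      refine ⟨by simp only; rw [abs_of_neg h]; ring, ?_⟩
      have := hasDerivAt_abs_affine (k ^ 2) x (-1) (Or.inr rfl) (by linarith)
      convert! this using 1
      ring
    · have h4 : sgn (-1 / Real.sqrt (-x) - k) = -1 := by
        apply sgn_of_neg
        rw [h1, h5]
        apply div_neg_of_neg_of_pos _ hs
        rw [h2] at h
        nlinarith [mul_pos (neg_pos.2 hk) hs]
      rw [h3, h4]
      refine ⟨by simp only; rw [abs_of_pos h]; ring, ?_⟩
      have := hasDerivAt_abs_affine (k ^ 2) x 1 (Or.inl rfl) (by linarith)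
      convert! this using 1
      ring

noncomputable def qR (k x : ℝ) : ℝ := if k ≤ 0 then 1 - x * k ^ 2 else |1 - x * k ^ 2|

lemma continuous_qR (k : ℝ) : Continuous (qR k) := by
  unfold qR
  split_ifs <;> fun_prop

lemma right_flux (k x : ℝ) (hx : 0 < x) (hne : x ∉ ({1 / k ^ 2} : Set ℝ)) :
      qR k x = sgn (1 / Real.sqrt x - k) * (x * (1 / Real.sqrt x) ^ 2 - x * k ^ 2) ∧
      HasDerivAt (qR k) (-(sgn (1 / Real.sqrt x - k) * k ^ 2)) x := by
  obtain ⟨s, hs, h1, h2, h3⟩ : ∃ s, 0 < s ∧ Real.sqrt x = s ∧ x = s ^ 2 ∧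
      x * (1 / Real.sqrt x) ^ 2 = 1 := by
    have h0 : 0 < Real.sqrt x := Real.sqrt_pos.2 hx
    have h1 : Real.sqrt x ^ 2 = x := Real.sq_sqrt hx.le
    refine ⟨_, h0, rfl, by linarith, ?_⟩
    rw [div_pow, h1]
    field_simp
  by_cases hk : k ≤ 0
  · have hq : qR k = fun x => 1 - x * k ^ 2 := by ext y; simp [qR, hk]
    have h4 : sgn (1 / Real.sqrt x - k) = 1 := by
      apply sgn_of_pos
      rw [h1]
      have : 0 < 1 / s := by positivity
      linarith
    rw [h3, h4, hq]
    refine ⟨by ring, ?_⟩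
    have := ((hasDerivAt_id x).mul_const (k ^ 2)).const_sub 1
    simpa using this
  · have hq : qR k = fun x => |1 + x * (-k ^ 2)| := by
      ext y; simp only [qR, if_neg hk]; congr 1; ring
    push Not at hk
    rw [hq]
    have hk2 : 0 < k ^ 2 := by positivity
    have hne' : 1 + x * (-k ^ 2) ≠ 0 := by
      intro h
      apply hne
      rw [mem_singleton_iff, eq_div_iff hk2.ne']
      linarith
    have h5 : 1 / s - k = (1 - k * s) / s := by field_simp
    rcases lt_or_gt_of_ne hne' with h | h
    · have h4 : sgn (1 / Real.sqrt x - k) = -1 := by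
        apply sgn_of_neg
        rw [h1, h5]
        apply div_neg_of_neg_of_pos _ hs
        rw [h2] at h
        nlinarith [mul_pos hk hs]
      rw [h3, h4]
      refine ⟨by simp only; rw [abs_of_neg h]; ring, ?_⟩
      have := hasDerivAt_abs_affine (-k ^ 2) x (-1) (Or.inr rfl) (by linarith)
      convert! this using 1
      ring
    · have h4 : sgn (1 / Real.sqrt x - k) = 1 := by
        apply sgn_of_pos
        rw [h1, h5]
        apply div_pos _ hs
        rw [h2] at h
        nlinarith [mul_pos hk hs]
      rw [h3, h4]
      refine ⟨by simp only; rw [abs_of_pos h]; ring, ?_⟩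
      have := hasDerivAt_abs_affine (-k ^ 2) x 1 (Or.inl rfl) (by linarith)
      convert! this using 1
      ring

lemma shock_ineq (k s : ℝ) (hs : 0 < s) :
    0 ≤ s / 2 * (|k| - |2 / s - k|) + (qR k (s ^ 2 / 4) - k * |k| * (s ^ 2 / 4)) := by
  have h5 : 2 / s - k = (2 - k * s) / s := by field_simp
  have h6 : s / 2 * |2 / s - k| = |2 - k * s| / 2 := by
    rw [h5, abs_div, abs_of_pos hs]; field_simp
  rw [mul_sub, h6]
  unfold qR
  split_ifs with hk
  · rw [abs_of_nonpos hk, abs_of_nonneg (by nlinarith)]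
    nlinarith
  · push Not at hk
    rw [abs_of_pos hk]
    have hks := mul_pos hk hs
    rcases le_total (k * s) 2 with h | h
    · rw [abs_of_nonneg (by linarith : 0 ≤ 2 - k * s), abs_of_nonneg (by nlinarith)]
      nlinarith
    · rw [abs_of_nonpos (by linarith : 2 - k * s ≤ 0), abs_of_nonpos (by nlinarith)]
      nlinarith

lemma piece {a b : ℝ} (hab : a ≤ b) {q g ψ ψ' h : ℝ → ℝ} {S : Set ℝ} (hS : S.Countable)
    (hq : Continuous q) (hg : ∀ x ∈ Ioo a b \ S, HasDerivAt q (g x) x)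
    (hψ : ∀ x, HasDerivAt ψ (ψ' x) x) (hh : IntervalIntegrable h volume a b)
    (he : ∀ x ∈ Ioo a b \ S, h x = g x * ψ x + q x * ψ' x) :
    ∫ x in a..b, h x = q b * ψ b - q a * ψ a := by
  have hψc : Continuous ψ := continuous_iff_continuousAt.2 fun x => (hψ x).continuousAt
  refine integral_eq_of_hasDerivAt_off_countable_of_le (fun x => q x * ψ x) h hab hS
    (hq.mul hψc).continuousOn ?_ hh
  intro x hx
  rw [he x hx]
  exact (hg x hx).mul (hψ x)

lemma space_int (lam k t M : ℝ) {ψ ψ' : ℝ → ℝ} (hψ : ∀ x, HasDerivAt ψ (ψ' x) x)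
    (hM : ∀ x, M < |x| → ψ x = 0 ∧ ψ' x = 0)
    (hint : Integrable (fun x => sgn (uFam lam (x, t) - k) *
      (x * (uFam lam (x, t)) ^ 2 - x * k ^ 2) * ψ' x - sgn (uFam lam (x, t) - k) * k ^ 2 * ψ x)) :
    ∫ x, (sgn (uFam lam (x, t) - k) *
      (x * (uFam lam (x, t)) ^ 2 - x * k ^ 2) * ψ' x - sgn (uFam lam (x, t) - k) * k ^ 2 * ψ x)
    = if lam < t then
        (qR k ((t - lam) ^ 2 / 4) - k * |k| * ((t - lam) ^ 2 / 4)) * ψ ((t - lam) ^ 2 / 4)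
      else ψ 0 := by
  set h : ℝ → ℝ := fun x => sgn (uFam lam (x, t) - k) *
      (x * (uFam lam (x, t)) ^ 2 - x * k ^ 2) * ψ' x - sgn (uFam lam (x, t) - k) * k ^ 2 * ψ x
    with hh
  set R := (max (t - lam) 0) ^ 2 / 4 with hR
  have hR0 : 0 ≤ R := by positivity
  set N := |M| + R + 1 with hN
  have hMN : M < N := by have := le_abs_self M; linarith
  have hN0 : 0 < N := by positivity
  have hRN : R ≤ N := by have := abs_nonneg M; linarith
  have hsup : Function.support h ⊆ Ioc (-N) N := by
    intro x hx
    by_contra hc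
    apply hx
    have : M < |x| := by
      by_contra h2
      push Not at h2
      exact hc ⟨by linarith [neg_abs_le x], by linarith [le_abs_self x]⟩
    simp [hh, hM x this]
  have hψN : ψ N = 0 := (hM N (by rwa [abs_of_pos hN0])).1
  have hψN' : ψ (-N) = 0 := (hM (-N) (by rwa [abs_neg, abs_of_pos hN0])).1
  rw [← intervalIntegral.integral_eq_integral_of_support_subset hsup,
    ← intervalIntegral.integral_add_adjacent_intervals (b := 0) hint.intervalIntegrable
      hint.intervalIntegrable,
    ← intervalIntegral.integral_add_adjacent_intervals (a := 0) (b := R) hint.intervalIntegrable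
      hint.intervalIntegrable]
  obtain ⟨q, hqc, hq0, hq⟩ := left_flux k
  have i1 : ∫ x in (-N)..0, h x = ψ 0 := by
    rw [piece (by linarith) (countable_singleton (-1 / k ^ 2)) hqc
      (fun x hx => (hq x hx.1.2 hx.2).2) hψ hint.intervalIntegrable, hq0, hψN']
    · ring
    · intro x hx
      simp only [hh]
      rw [uFam_neg hx.1.2, (hq x hx.1.2 hx.2).1]
      ring
  have i2 : ∫ x in (0 : ℝ)..R, h x = qR k R * ψ R - qR k 0 * ψ 0 := by
    refine piece hR0 (countable_singleton (1 / k ^ 2)) (continuous_qR k)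
      (fun x hx => (right_flux k x hx.1.1 hx.2).2) hψ hint.intervalIntegrable ?_
    intro x hx
    simp only [hh]
    rw [uFam_mid hx.1.1 hx.1.2, (right_flux k x hx.1.1 hx.2).1]
    ring
  have hk : sgn (0 - k) * k ^ 2 = - (k * |k|) := by
    unfold sgn
    split_ifs with h0
    · rw [abs_of_nonpos (by linarith)]; ring
    · rw [abs_of_pos (by linarith)]; ring
  have i3 : ∫ x in R..N, h x = - (k * |k| * R) * ψ R := by
    rw [piece hRN (countable_empty) (q := fun x => x * (k * |k|)) (by fun_prop)
      (g := fun _ => k * |k|)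
      (fun x hx => by simpa using (hasDerivAt_id x).mul_const (k * |k|)) hψ
      hint.intervalIntegrable, hψN]
    · ring
    · intro x hx
      simp only [hh]
      rw [uFam_far (hR0.trans hx.1.1.le) hx.1.1.le]
      linear_combination (-x * ψ' x - ψ x) * hk
  have hq00 : qR k 0 = 1 := by unfold qR; split_ifs <;> simp
  rw [i1, i2, i3, hq00]
  split_ifs with hlt
  · have : R = (t - lam) ^ 2 / 4 := by rw [hR, max_eq_left (by linarith)]
    rw [← this]; ring
  · have : R = 0 := by rw [hR, max_eq_right (by linarith)]; norm_num
    rw [this, hq00]; ring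

lemma ioi_int {ψ ψ' : ℝ → ℝ} {M : ℝ} (hψ : ∀ x, HasDerivAt ψ (ψ' x) x) (hc : Continuous ψ')
    (hM : ∀ x, M < |x| → ψ x = 0 ∧ ψ' x = 0) (b : ℝ) :
    Integrable ψ' ∧ ∫ x in Ioi b, ψ' x = - ψ b := by
  have hcs : HasCompactSupport ψ' := by
    refine HasCompactSupport.intro (K := Icc (-M) M) isCompact_Icc ?_
    intro x hx
    refine (hM x ?_).2
    by_contra h2
    exact hx (abs_le.1 (not_lt.1 h2))
  have hi := hc.integrable_of_hasCompactSupport hcs (μ := volume)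
  refine ⟨hi, ?_⟩
  have ht : Tendsto ψ atTop (nhds 0) := by
    apply tendsto_const_nhds.congr'
    filter_upwards [eventually_gt_atTop M] with x hx
    exact (hM x (hx.trans_le (le_abs_self x))).1.symm
  rw [integral_Ioi_of_hasDerivAt_of_tendsto (hψ b).continuousAt.continuousWithinAt
    (fun x _ => hψ x) hi.integrableOn ht]
  ring

lemma time_int (lam k x M : ℝ) (hl : 0 ≤ lam) (hx : x ≠ 0) {ψ ψ' : ℝ → ℝ}
    (hψ : ∀ t, HasDerivAt ψ (ψ' t) t) (hc : Continuous ψ')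
    (hM : ∀ t, M < |t| → ψ t = 0 ∧ ψ' t = 0) :
    (∫ t in Ioi (0 : ℝ), |uFam lam (x, t) - k| * ψ' t) + |uInit x - k| * ψ 0
    = indicator (Ioi 0) (fun x => (|k| - |1 / Real.sqrt x - k|) * ψ (lam + 2 * Real.sqrt x)) x := by
  have h0 := ioi_int hψ hc hM 0
  rcases lt_or_gt_of_ne hx with h | h
  · rw [indicator_of_notMem (by simpa using h.le)]
    have : uInit x = -1 / Real.sqrt (-x) := by simp [uInit, h]
    simp_rw [uFam_neg h, this]
    rw [integral_const_mul, h0.2]; ring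
  · rw [indicator_of_mem (by exact h)]
    have hT : 0 ≤ lam + 2 * Real.sqrt x := by positivity
    have h1 := ioi_int hψ hc hM (lam + 2 * Real.sqrt x)
    have hu : uInit x = 0 := by simp [uInit, h.le]
    have e : (fun t => |uFam lam (x, t) - k| * ψ' t) = fun t => |k| * ψ' t +
        indicator (Ioi (lam + 2 * Real.sqrt x)) (fun t => (|1 / Real.sqrt x - k| - |k|) * ψ' t) t := by
      ext t
      by_cases ht : lam + 2 * Real.sqrt x < t
      · rw [indicator_of_mem (by exact ht), uFam_mid h ((front_iff h).2 ht)]; ring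
      · rw [indicator_of_notMem (by exact ht), uFam_far h.le (not_lt.1 (mt (front_iff h).1 ht))]
        simp
    rw [e, integral_add (h0.1.const_mul _).integrableOn
      ((h1.1.const_mul _).indicator measurableSet_Ioi).integrableOn, integral_const_mul, h0.2,
      setIntegral_indicator measurableSet_Ioi, Ioi_inter_Ioi, sup_eq_right.2 hT,
      integral_const_mul, h1.2, hu, zero_sub, abs_neg]
    ring

structure TD (φ φt φx : ℝ × ℝ → ℝ) (C M : ℝ) : Prop where
  c0 : Continuous φ
  ct : Continuous φt
  cx : Continuous φx
  dt : ∀ x t, HasDerivAt (fun t => φ (x, t)) (φt (x, t)) t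
  dx : ∀ x t, HasDerivAt (fun x => φ (x, t)) (φx (x, t)) x
  C0 : 0 ≤ C
  M0 : 0 ≤ M
  b0 : ∀ p, |φ p| ≤ C
  bt : ∀ p, |φt p| ≤ C
  bx : ∀ p, |φx p| ≤ C
  z : ∀ x t, (M < |x| ∨ M < |t|) → φ (x, t) = 0 ∧ φt (x, t) = 0 ∧ φx (x, t) = 0

lemma exists_TD (φ : ℝ × ℝ → ℝ) (h : ContDiff ℝ (⊤ : ℕ∞) φ) (hc : HasCompactSupport φ) :
    ∃ C M, TD φ (fun p => fderiv ℝ φ p (0, 1)) (fun p => fderiv ℝ φ p (1, 0)) C M := by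
  have hd : Differentiable ℝ φ := h.differentiable (by simp)
  have hcf : Continuous (fderiv ℝ φ) := h.continuous_fderiv (by simp)
  obtain ⟨C1, hC1⟩ := hc.exists_bound_of_continuous h.continuous
  obtain ⟨C2, hC2⟩ := (hc.fderiv (𝕜 := ℝ)).exists_bound_of_continuous hcf
  obtain ⟨M, hM⟩ := hc.isCompact.isBounded.subset_closedBall 0
  have hb : ∀ p v, ‖v‖ ≤ 1 → |fderiv ℝ φ p v| ≤ max C1 C2 := by
    intro p v hv
    have h1 := (fderiv ℝ φ p).le_opNorm v
    have h2 : ‖fderiv ℝ φ p‖ * ‖v‖ ≤ ‖fderiv ℝ φ p‖ * 1 := by gcongr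
    have h3 := hC2 p
    rw [Real.norm_eq_abs] at h1
    exact (by linarith : _ ≤ C2).trans (le_max_right _ _)
  refine ⟨max C1 C2, max M 0, h.continuous, by fun_prop, by fun_prop, ?_, ?_, ?_, ?_, ?_, ?_, ?_, ?_⟩
  · intro x t
    exact (hd (x, t)).hasFDerivAt.comp_hasDerivAt t ((hasDerivAt_const t x).prodMk (hasDerivAt_id t))
  · intro x t
    exact (hd (x, t)).hasFDerivAt.comp_hasDerivAt x ((hasDerivAt_id x).prodMk (hasDerivAt_const x t))
  · exact (norm_nonneg _).trans ((hC1 0).trans (le_max_left _ _))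
  · exact le_max_right _ _
  · exact fun p => (hC1 p).trans (le_max_left _ _)
  · exact fun p => hb p _ (by simp [Prod.norm_def])
  · exact fun p => hb p _ (by simp [Prod.norm_def])
  · intro x t hxt
    have hn : (x, t) ∉ tsupport φ := by
      intro hmem
      have := hM hmem
      rw [mem_closedBall_zero_iff, Prod.norm_def, max_le_iff] at this
      simp only [Real.norm_eq_abs] at this
      rcases hxt with h | h
      · linarith [le_max_left M 0]
      · linarith [le_max_left M 0]
    have h1 : fderiv ℝ φ (x, t) = 0 := by
      by_contra h2
      exact hn (support_fderiv_subset ℝ h2)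
    exact ⟨image_eq_zero_of_notMem_tsupport hn, by simp [h1], by simp [h1]⟩

lemma box_int {F : ℝ × ℝ → ℝ} (hF : Measurable F) {A B M : ℝ} (hM : 0 ≤ M)
    (hb : ∀ t x, |x| ≤ M → |F (t, x)| ≤ A * (1 / Real.sqrt |x|) + B)
    (hz : ∀ t x, (M < |x| ∨ M < |t|) → F (t, x) = 0) :
    Integrable F ((volume.restrict (Ioi (0 : ℝ))).prod volume) := by
  have h1 : Integrable (indicator (Icc (-M) M) (fun _ : ℝ => (1 : ℝ)))
      (volume.restrict (Ioi (0 : ℝ))) := by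
    apply Integrable.restrict
    rw [integrable_indicator_iff measurableSet_Icc]
    exact integrableOn_const (by simp)
  have h2 : Integrable (indicator (Icc (-M) M) (fun x : ℝ => A * (1 / Real.sqrt |x|) + B)) := by
    rw [integrable_indicator_iff measurableSet_Icc]
    exact ((invsqrt_int M hM).const_mul A).add (integrableOn_const (by simp))
  refine (h1.mul_prod h2).mono' hF.aestronglyMeasurable (Eventually.of_forall ?_)
  rintro ⟨t, x⟩
  by_cases h : M < |x| ∨ M < |t|
  · rw [hz t x h, norm_zero]
    refine mul_nonneg (indicator_nonneg (by simp) _) ?_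
    apply indicator_nonneg
    intro y hy
    exact (abs_nonneg _).trans (hb t y (abs_le.2 hy))
  · push Not at h
    simp only
    rw [indicator_of_mem (by exact abs_le.1 h.2), indicator_of_mem (by exact abs_le.1 h.1), one_mul]
    exact hb t x h.1

lemma init_int {g : ℝ → ℝ} (hg : Measurable g) {A B M : ℝ} (hM : 0 ≤ M)
    (hb : ∀ x, |x| ≤ M → |g x| ≤ A * (1 / Real.sqrt |x|) + B)
    (hz : ∀ x, M < |x| → g x = 0) : Integrable g := by
  have h2 : Integrable (indicator (Icc (-M) M) (fun x : ℝ => A * (1 / Real.sqrt |x|) + B)) := by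
    rw [integrable_indicator_iff measurableSet_Icc]
    exact ((invsqrt_int M hM).const_mul A).add (integrableOn_const (by simp))
  refine h2.mono' hg.aestronglyMeasurable (Eventually.of_forall ?_)
  intro x
  by_cases h : M < |x|
  · rw [hz x h, norm_zero]
    apply indicator_nonneg
    intro y hy
    exact (abs_nonneg _).trans (hb y (abs_le.2 hy))
  · push Not at h
    rw [indicator_of_mem (by exact abs_le.1 h)]
    exact hb x h

lemma image_front (lam : ℝ) : (fun t : ℝ => (t - lam) ^ 2 / 4) '' Ioi lam = Ioi 0 := by
  ext x
  constructor
  · rintro ⟨t, ht, rfl⟩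
    have : 0 < t - lam := sub_pos.2 ht
    simp only [mem_Ioi]
    positivity
  · intro hx
    have hx' : 0 < x := hx
    have := Real.sqrt_pos.2 hx'
    refine ⟨lam + 2 * Real.sqrt x, by simp only [mem_Ioi]; linarith, ?_⟩
    have h1 : Real.sqrt x ^ 2 = x := Real.sq_sqrt hx'.le
    simp only
    linear_combination h1

lemma entropy_main (lam k C M : ℝ) (hl : 0 ≤ lam) (φ φt φx : ℝ × ℝ → ℝ) (H : TD φ φt φx C M)
    (hpos : ∀ p, 0 ≤ φ p) :
    0 ≤ (∫ t in Ioi (0 : ℝ), ∫ x : ℝ,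
          (|uFam lam (x, t) - k| * φt (x, t)
            + sgn (uFam lam (x, t) - k) * (x * (uFam lam (x, t)) ^ 2 - x * k ^ 2) * φx (x, t)
            - sgn (uFam lam (x, t) - k) * k ^ 2 * φ (x, t)))
        + ∫ x : ℝ, |uInit x - k| * φ (x, 0) := by
  have mu : Measurable (fun p : ℝ × ℝ => uFam lam (p.2, p.1)) :=
    (measurable_uFam lam).comp measurable_swap
  have ms : Measurable (fun p : ℝ × ℝ => sgn (uFam lam (p.2, p.1) - k)) :=
    measurable_sgn.comp (mu.sub_const k)
  have m0 := H.c0.measurable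
  have mt := H.ct.measurable
  have mx := H.cx.measurable
  have absu : ∀ x t, |(|uFam lam (x, t) - k|)| ≤ 1 / Real.sqrt |x| + |k| := by
    intro x t
    rw [abs_abs]
    exact (abs_sub _ _).trans (by gcongr; exact abs_uFam_le lam x t)
  let f1 : ℝ × ℝ → ℝ := fun p => |uFam lam (p.2, p.1) - k| * φt (p.2, p.1)
  let f2 : ℝ × ℝ → ℝ := fun p =>
    sgn (uFam lam (p.2, p.1) - k) * (p.2 * (uFam lam (p.2, p.1)) ^ 2 - p.2 * k ^ 2) * φx (p.2, p.1)
            - sgn (uFam lam (p.2, p.1) - k) * k ^ 2 * φ (p.2, p.1)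
  have I1 : Integrable f1 ((volume.restrict (Ioi (0 : ℝ))).prod volume) := by
    refine box_int (A := C) (B := |k| * C) (M := M) (by fun_prop) H.M0 ?_ ?_
    · intro t x _
      simp only [f1]
      rw [abs_mul]
      calc _ ≤ (1 / Real.sqrt |x| + |k|) * C := by
            gcongr
            · exact absu x t
            · exact H.bt _
        _ = _ := by ring
    · intro t x h
      simp [f1, (H.z x t h).2.1]
  have I2 : Integrable f2 ((volume.restrict (Ioi (0 : ℝ))).prod volume) := by
    refine box_int (A := 0) (B := (1 + M * k ^ 2) * C + k ^ 2 * C) (M := M) (by fun_prop) H.M0 ?_ ?_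
    · intro t x hx
      simp only [f2]
      rw [zero_mul, zero_add]
      refine (abs_sub _ _).trans ?_
      rw [abs_mul, abs_mul, abs_sgn, one_mul, abs_mul, abs_mul, abs_sgn, one_mul, abs_sq]
      have hC := H.C0
      have hM0 := H.M0
      gcongr
      · refine (abs_sub _ _).trans ?_
        rw [abs_mul x (k ^ 2), abs_sq]
        gcongr
        exact abs_x_uFam_sq_le lam x t
      · exact H.bx _
      · exact H.b0 _
    · intro t x h
      simp [f2, (H.z x t h).1, (H.z x t h).2.2]
  have I0 : Integrable (fun x => |uInit x - k| * φ (x, 0)) := by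
    have e : uInit = fun x => uFam lam (x, 0) := by ext x; rw [uFam_zero_eq hl]
    rw [e]
    have mu0 : Measurable (fun x : ℝ => uFam lam (x, 0)) :=
      (measurable_uFam lam).comp (by fun_prop)
    refine init_int (A := C) (B := |k| * C) (M := M) (by fun_prop) H.M0 ?_ ?_
    · intro x _
      rw [abs_mul]
      calc _ ≤ (1 / Real.sqrt |x| + |k|) * C := by
            gcongr
            · exact absu x 0
            · exact H.b0 _
        _ = _ := by ring
    · intro x h
      simp [(H.z x 0 (Or.inl h)).1]
  let g : ℝ → ℝ := fun x => (|k| - |1 / Real.sqrt x - k|) * φ (x, lam + 2 * Real.sqrt x)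
  have IK : Integrable (fun x => ∫ t in Ioi (0 : ℝ), f1 (t, x)) := I1.integral_prod_right
  have eK : ∀ᵐ x : ℝ, (∫ t in Ioi (0 : ℝ), f1 (t, x)) + |uInit x - k| * φ (x, 0)
      = indicator (Ioi 0) g x := by
    have h0 : ∀ᵐ x : ℝ, x ≠ 0 := by simp [ae_iff]
    filter_upwards [h0] with x hx
    have := time_int lam k x M hl hx (ψ := fun t => φ (x, t)) (ψ' := fun t => φt (x, t))
      (H.dt x) (H.ct.comp (by fun_prop)) (fun t ht => ⟨(H.z x t (Or.inr ht)).1, (H.z x t (Or.inr ht)).2.1⟩)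
    rw [this]
    by_cases hx0 : 0 < x
    · rw [indicator_of_mem (by exact hx0), indicator_of_mem (by exact hx0)]
    · rw [indicator_of_notMem (by exact hx0), indicator_of_notMem (by exact hx0)]
  have Ig : IntegrableOn g (Ioi 0) := by
    rw [← integrable_indicator_iff measurableSet_Ioi]
    exact (IK.add I0).congr eK
  have hder : ∀ t ∈ Ioi lam, HasDerivWithinAt (fun t : ℝ => (t - lam) ^ 2 / 4) ((t - lam) / 2)
      (Ioi lam) t := by
    intro t _
    have := ((((hasDerivAt_id t).sub_const lam).pow 2).div_const 4).hasDerivWithinAt (s := Ioi lam)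
    convert! this using 1
    simp; ring
  have hinj : InjOn (fun t : ℝ => (t - lam) ^ 2 / 4) (Ioi lam) := by
    intro a ha b hb hab
    simp only [mem_Ioi] at ha hb hab
    have h1 : (a - b) * ((a - lam) + (b - lam)) = 0 := by linear_combination 4 * hab
    rcases mul_eq_zero.1 h1 with h | h <;> linarith
  have cv := integral_image_eq_integral_abs_deriv_smul measurableSet_Ioi hder hinj g
  have cvi := (integrableOn_image_iff_integrableOn_abs_deriv_smul measurableSet_Ioi hder hinj g).1
    (by rwa [image_front])
  rw [image_front] at cv
  set G : ℝ → ℝ := fun t => |(t - lam) / 2| • g ((t - lam) ^ 2 / 4) with hG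
  have IJ : Integrable (fun t => ∫ x, f2 (t, x)) (volume.restrict (Ioi (0 : ℝ))) :=
    I2.integral_prod_left
  have eq1 : (∫ t in Ioi (0 : ℝ), ∫ x : ℝ,
          (|uFam lam (x, t) - k| * φt (x, t)
            + sgn (uFam lam (x, t) - k) * (x * (uFam lam (x, t)) ^ 2 - x * k ^ 2) * φx (x, t)
            - sgn (uFam lam (x, t) - k) * k ^ 2 * φ (x, t)))
      = (∫ t in Ioi (0 : ℝ), ∫ x, f1 (t, x)) + ∫ t in Ioi (0 : ℝ), ∫ x, f2 (t, x) := by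
    rw [← integral_integral_add I1 I2]
    simp only [f1, f2, add_sub_assoc]
  have eq2 : (∫ t in Ioi (0 : ℝ), ∫ x, f1 (t, x)) + ∫ x : ℝ, |uInit x - k| * φ (x, 0)
      = ∫ t in Ioi (0 : ℝ), indicator (Ioi lam) G t := by
    rw [integral_integral_swap (f := fun t x => f1 (t, x)) I1, ← integral_add IK I0,
      integral_congr_ae eK, integral_indicator measurableSet_Ioi, cv,
      setIntegral_indicator measurableSet_Ioi, Ioi_inter_Ioi, sup_eq_right.2 hl]
  have IG : Integrable (indicator (Ioi lam) G) (volume.restrict (Ioi (0 : ℝ))) := by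
    apply Integrable.restrict
    rwa [integrable_indicator_iff measurableSet_Ioi]
  rw [eq1, add_right_comm, eq2, ← integral_add IG IJ]
  apply integral_nonneg_of_ae
  filter_upwards [I2.prod_right_ae] with t ht
  have hJ := space_int lam k t M (ψ := fun x => φ (x, t)) (ψ' := fun x => φx (x, t))
      (fun x => H.dx x t) (fun x hx => ⟨(H.z x t (Or.inl hx)).1, (H.z x t (Or.inl hx)).2.2⟩) ht
  have hJ' : ∫ x, f2 (t, x) = _ := hJ
  simp only [Pi.zero_apply]
  rw [hJ']
  by_cases hlt : lam < t
  · rw [if_pos hlt, indicator_of_mem (by exact hlt)]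
    have hs : 0 < t - lam := sub_pos.2 hlt
    have e4 : Real.sqrt ((t - lam) ^ 2 / 4) = (t - lam) / 2 := by
      rw [show (t - lam) ^ 2 / 4 = ((t - lam) / 2) ^ 2 by ring, Real.sqrt_sq (by positivity)]
    simp only [hG, g, smul_eq_mul, e4]
    rw [show lam + 2 * ((t - lam) / 2) = t by ring, abs_of_pos (by positivity : 0 < (t - lam) / 2),
      show 1 / ((t - lam) / 2) = 2 / (t - lam) by field_simp]
    have := mul_nonneg (shock_ineq k (t - lam) hs) (hpos ((t - lam) ^ 2 / 4, t))
    linarith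
  · rw [if_neg hlt, indicator_of_notMem (by exact hlt), zero_add]
    exact hpos _

/-- each `u_λ` (λ ≥ 0) is a Kružkov entropy solution of
`u_t + (x u²)_x = 0` with initial datum `uInit`, each is `L¹`-continuous at `t = 0`,
and distinct parameters give solutions differing on a set of positive measure:
infinitely many entropy solutions. -/
theorem statement1 :
    (∀ lam : ℝ, 0 ≤ lam → EntropySol (uFam lam) uInit) ∧
    (∀ lam : ℝ, 0 ≤ lam →
      Tendsto (fun t => ∫ x : ℝ, |uFam lam (x, t) - uInit x|)
        (nhdsWithin 0 (Ioi 0)) (nhds 0)) ∧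
    (∀ lam mu : ℝ, 0 ≤ lam → 0 ≤ mu → lam ≠ mu →
      0 < volume {p : ℝ × ℝ | 0 < p.2 ∧ uFam lam p ≠ uFam mu p}) := by
  refine ⟨?_, part_ii, part_iii⟩
  intro lam hl k φ hφ hc hpos
  obtain ⟨C, M, H⟩ := exists_TD φ hφ hc
  exact entropy_main lam k C M hl φ _ _ H hpos
end
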